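/- For the 2+1-dimensional metric ansatz g_a = −dt² + dr² + (r + χ(q) a(θ) q)² dθ² + J(θ)χ(q) dq dθ, with a(θ) = a₀ + a₁cos θ + a₂sin θ, the metric is Ricci-flat in the region q > R+1 where χ ≡ 1; i.e. the Lorentzian metric g = −dt² + dr² + (r + a(θ)q)² dθ² + J(θ) dq dθ with q = r − t and a(θ) = a₀ + a₁cos θ + a₂sin θ satisfies Ric(g) = 0 wherever r + a(θ)q > 0. -/

import Mathlib

noncomputable section

/-- Coordinate point `(t, r, θ)` on `ℝ × (0,∞) × S¹` (coordinates unrolled to `ℝ³`). -/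
abbrev Pt : Type := ℝ × ℝ × ℝ

/-- Derivative of `u` along the constant vector `v`. -/
def pd (v : Pt) (u : Pt → ℝ) : Pt → ℝ := fun p => fderiv ℝ u p v

/-- Coordinate basis vectors `∂_t, ∂_r, ∂_θ`. -/
def eB : Fin 3 → Pt := ![(1, 0, 0), (0, 1, 0), (0, 0, 1)]

/-- Christoffel symbols `Γ^l_{ij} = (1/2) g^{lm}(∂_i g_{mj} + ∂_j g_{mi} − ∂_m g_{ij})`
of a metric field `g` given in coordinates. -/
def Christoffel (g : Pt → Matrix (Fin 3) (Fin 3) ℝ) (p : Pt) (l i j : Fin 3) : ℝ :=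
  (1 / 2) * ∑ m : Fin 3, (g p)⁻¹ l m *
    (pd (eB i) (fun p' => g p' m j) p + pd (eB j) (fun p' => g p' m i) p
      - pd (eB m) (fun p' => g p' i j) p)

/-- The Ricci tensor
`R_{ij} = ∂_l Γ^l_{ij} − ∂_i Γ^l_{lj} + Γ^l_{lm}Γ^m_{ij} − Γ^l_{im}Γ^m_{lj}`. -/
def RicciT (g : Pt → Matrix (Fin 3) (Fin 3) ℝ) (p : Pt) (i j : Fin 3) : ℝ :=
  (∑ l : Fin 3, pd (eB l) (fun p' => Christoffel g p' l i j) p)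
  - (∑ l : Fin 3, pd (eB i) (fun p' => Christoffel g p' l l j) p)
  + (∑ l : Fin 3, ∑ m : Fin 3, Christoffel g p l l m * Christoffel g p m i j)
  - (∑ l : Fin 3, ∑ m : Fin 3, Christoffel g p l i m * Christoffel g p m l j)

/-- The metric `g = −dt² + dr² + (r + a(θ)q)² dθ² + J(θ) dq dθ`, `q = r − t`,
`a(θ) = a₀ + a₁cos θ + a₂sin θ`, in the coordinates `(t, r, θ)` (with
`J dq dθ = J dr dθ − J dt dθ` as a symmetric product). -/
def gA (a0 a1 a2 : ℝ) (J : ℝ → ℝ) (p : Pt) : Matrix (Fin 3) (Fin 3) ℝ :=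
  !![(-1 : ℝ), 0, -(J p.2.2) / 2;
     0, 1, (J p.2.2) / 2;
     -(J p.2.2) / 2, (J p.2.2) / 2,
       (p.2.1 + (a0 + a1 * Real.cos p.2.2 + a2 * Real.sin p.2.2) * (p.2.1 - p.1)) ^ 2]

structure HD (u : Pt → ℝ) (p : Pt) (d : Fin 3 → ℝ) : Prop where
  diff : DifferentiableAt ℝ u p
  eq : ∀ i, pd (eB i) u p = d i

theorem HD.const (c : ℝ) (p : Pt) : HD (fun _ => c) p (fun _ => 0) :=
  ⟨differentiableAt_const c, fun i => by simp [pd]⟩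

theorem HD.add {u v : Pt → ℝ} {p : Pt} {d e : Fin 3 → ℝ} (hu : HD u p d) (hv : HD v p e) :
    HD (fun x => u x + v x) p (fun i => d i + e i) :=
  ⟨hu.diff.add hv.diff, fun i => by
    rw [← hu.eq, ← hv.eq]; simp only [pd]; rw [fderiv_fun_add hu.diff hv.diff]; rfl⟩

theorem HD.mul {u v : Pt → ℝ} {p : Pt} {d e : Fin 3 → ℝ} (hu : HD u p d) (hv : HD v p e) :
    HD (fun x => u x * v x) p (fun i => u p * e i + v p * d i) :=
  ⟨hu.diff.mul hv.diff, fun i => by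
    rw [← hu.eq, ← hv.eq]; simp only [pd]; rw [fderiv_fun_mul hu.diff hv.diff]; simp⟩

theorem HD.comp {f : ℝ → ℝ} {u : Pt → ℝ} {p : Pt} {d : Fin 3 → ℝ} {f' : ℝ}
    (hf : HasDerivAt f f' (u p)) (hu : HD u p d) :
    HD (fun x => f (u x)) p (fun i => f' * d i) := by
  have h := hf.comp_hasFDerivAt p hu.diff.hasFDerivAt
  refine ⟨h.differentiableAt, fun i => ?_⟩
  rw [← hu.eq]; simp only [pd]
  have h2 : fderiv ℝ (fun x => f (u x)) p = _ := h.fderiv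
  rw [h2]; simp

theorem HD.inv {u : Pt → ℝ} {p : Pt} {d : Fin 3 → ℝ} (hu : HD u p d) (h0 : u p ≠ 0) :
    HD (fun x => (u x)⁻¹) p (fun i => -(u p ^ 2)⁻¹ * d i) :=
  HD.comp (hasDerivAt_inv h0) hu

theorem HD.congr {u v : Pt → ℝ} {p : Pt} {d e : Fin 3 → ℝ} (hu : HD u p d)
    (h : v =ᶠ[nhds p] u) (hd : ∀ i, d i = e i) : HD v p e :=
  ⟨hu.diff.congr_of_eventuallyEq h, fun i => by
    rw [← hd, ← hu.eq]; simp only [pd]; rw [h.fderiv_eq]⟩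

theorem HD.t (p : Pt) : HD (fun x => x.1) p ![1, 0, 0] :=
  ⟨differentiableAt_fst, fun i => by
    simp only [pd]; rw [fderiv_fst]; fin_cases i <;> simp [eB]⟩

theorem HD.r (p : Pt) : HD (fun x => x.2.1) p ![0, 1, 0] := by
  have h : HasFDerivAt (fun x : Pt => x.2.1)
    ((ContinuousLinearMap.fst ℝ ℝ ℝ).comp (ContinuousLinearMap.snd ℝ ℝ (ℝ × ℝ))) p :=
    ((ContinuousLinearMap.fst ℝ ℝ ℝ).comp (ContinuousLinearMap.snd ℝ ℝ (ℝ × ℝ))).hasFDerivAt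
  exact ⟨h.differentiableAt, fun i => by
    simp only [pd]; rw [h.fderiv]; fin_cases i <;> simp [eB]⟩

theorem HD.h (p : Pt) : HD (fun x => x.2.2) p ![0, 0, 1] := by
  have h : HasFDerivAt (fun x : Pt => x.2.2)
    ((ContinuousLinearMap.snd ℝ ℝ ℝ).comp (ContinuousLinearMap.snd ℝ ℝ (ℝ × ℝ))) p :=
    ((ContinuousLinearMap.snd ℝ ℝ ℝ).comp (ContinuousLinearMap.snd ℝ ℝ (ℝ × ℝ))).hasFDerivAt
  exact ⟨h.differentiableAt, fun i => by
    simp only [pd]; rw [h.fderiv]; fin_cases i <;> simp [eB]⟩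

/-- general version of the metric -/
def gG (A J : ℝ → ℝ) (p : Pt) : Matrix (Fin 3) (Fin 3) ℝ :=
  !![(-1 : ℝ), 0, -(J p.2.2) / 2;
     0, 1, (J p.2.2) / 2;
     -(J p.2.2) / 2, (J p.2.2) / 2, (p.2.1 + A p.2.2 * (p.2.1 - p.1)) ^ 2]

def PP (A : ℝ → ℝ) (p : Pt) : ℝ := p.2.1 + A p.2.2 * (p.2.1 - p.1)

def PT (A1 : ℝ → ℝ) (p : Pt) : ℝ := A1 p.2.2 * (p.2.1 - p.1)

theorem HD.th {f f1 : ℝ → ℝ} (hf : ∀ x, HasDerivAt f (f1 x) x) (p : Pt) :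
    HD (fun x => f x.2.2) p ![0, 0, f1 p.2.2] :=
  (HD.comp (u := fun x => x.2.2) (hf p.2.2) (HD.h p)).congr (Filter.EventuallyEq.refl _ _)
    (fun i => by fin_cases i <;> simp)

theorem HD.PP {A A1 : ℝ → ℝ} (hA : ∀ x, HasDerivAt A (A1 x) x) (p : Pt) :
    HD (PP A) p ![-A p.2.2, 1 + A p.2.2, PT A1 p] :=
  ((HD.r p).add ((HD.th hA p).mul ((HD.r p).add ((HD.const (-1) p).mul (HD.t p))))).congr
    (Filter.Eventually.of_forall fun x => by simp only [_root_.PP]; ring)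
    (fun i => by fin_cases i <;> simp [PT]; ring)

theorem HD.PT {A1 A2 : ℝ → ℝ} (hA : ∀ x, HasDerivAt A1 (A2 x) x) (p : Pt) :
    HD (PT A1) p ![-A1 p.2.2, A1 p.2.2, PT A2 p] :=
  ((HD.th hA p).mul ((HD.r p).add ((HD.const (-1) p).mul (HD.t p)))).congr
    (Filter.Eventually.of_forall fun x => by simp only [_root_.PT]; ring)
    (fun i => by fin_cases i <;> simp [_root_.PT]; ring)

theorem gG_inv (A J : ℝ → ℝ) (p : Pt) (h : PP A p ≠ 0) :
    (gG A J p)⁻¹ =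
      !![-1 + J p.2.2 ^ 2 / 4 / PP A p ^ 2, J p.2.2 ^ 2 / 4 / PP A p ^ 2,
          - J p.2.2 / 2 / PP A p ^ 2;
        J p.2.2 ^ 2 / 4 / PP A p ^ 2, 1 + J p.2.2 ^ 2 / 4 / PP A p ^ 2,
          - J p.2.2 / 2 / PP A p ^ 2;
        - J p.2.2 / 2 / PP A p ^ 2, - J p.2.2 / 2 / PP A p ^ 2, 1 / PP A p ^ 2] := by
  apply Matrix.inv_eq_right_inv
  have e : gG A J p = !![(-1 : ℝ), 0, -(J p.2.2) / 2;
     0, 1, (J p.2.2) / 2;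
     -(J p.2.2) / 2, (J p.2.2) / 2, PP A p ^ 2] := rfl
  rw [e]
  ext i j
  fin_cases i <;> fin_cases j <;> simp [Matrix.mul_apply, Fin.sum_univ_three] <;> field_simp <;>
    ring

/-- table of first derivatives of the metric: `dg m j i = ∂_i g_{mj}`. -/
def dg (A A1 J J1 : ℝ → ℝ) (p : Pt) : Fin 3 → Fin 3 → Fin 3 → ℝ :=
  ![![0, 0, ![0, 0, -J1 p.2.2 / 2]],
    ![0, 0, ![0, 0, J1 p.2.2 / 2]],
    ![![0, 0, -J1 p.2.2 / 2], ![0, 0, J1 p.2.2 / 2],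
      ![-2 * PP A p * A p.2.2, 2 * PP A p * (1 + A p.2.2), 2 * PP A p * PT A1 p]]]

theorem HD.dg {A A1 J J1 : ℝ → ℝ} (hA : ∀ x, HasDerivAt A (A1 x) x)
    (hJ : ∀ x, HasDerivAt J (J1 x) x) (p : Pt) (m j : Fin 3) :
    HD (fun x => gG A J x m j) p (dg A A1 J J1 p m j) := by
  have h1 : HD (fun x => -(J x.2.2) / 2) p ![0, 0, -J1 p.2.2 / 2] :=
    ((HD.const (-1 / 2) p).mul (HD.th hJ p)).congr
      (Filter.Eventually.of_forall fun x => by simp; ring)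
      (fun i => by fin_cases i <;> simp; ring)
  have h2 : HD (fun x => (J x.2.2) / 2) p ![0, 0, J1 p.2.2 / 2] :=
    ((HD.const (1 / 2) p).mul (HD.th hJ p)).congr
      (Filter.Eventually.of_forall fun x => by simp; ring)
      (fun i => by fin_cases i <;> simp; ring)
  have h3 : HD (fun x => _root_.PP A x ^ 2) p ![-2 * _root_.PP A p * A p.2.2,
      2 * _root_.PP A p * (1 + A p.2.2), 2 * _root_.PP A p * _root_.PT A1 p] :=
    ((HD.PP hA p).mul (HD.PP hA p)).congr
      (Filter.Eventually.of_forall fun x => by simp; ring)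
      (fun i => by fin_cases i <;> simp <;> ring)
  fin_cases m <;> fin_cases j
  · exact HD.const _ p
  · exact HD.const _ p
  · exact h1
  · exact HD.const _ p
  · exact HD.const _ p
  · exact h2
  · exact h1
  · exact h2
  · exact h3

def fU (A J : ℝ → ℝ) (p : Pt) : ℝ :=
  J p.2.2 * A p.2.2 / 2 * (PP A p)⁻¹

def fV (A J : ℝ → ℝ) (p : Pt) : ℝ :=
  -(J p.2.2 * (1 + A p.2.2) / 2) * (PP A p)⁻¹

def fW (A : ℝ → ℝ) (p : Pt) : ℝ :=
  -A p.2.2 * (PP A p)⁻¹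

def fZ (A : ℝ → ℝ) (p : Pt) : ℝ :=
  (1 + A p.2.2) * (PP A p)⁻¹

def fT (A A1 J : ℝ → ℝ) (p : Pt) : ℝ :=
  (PT A1 p + J p.2.2 / 2) * (PP A p)⁻¹

def fX (A A1 J J1 : ℝ → ℝ) (p : Pt) : ℝ :=
  J1 p.2.2 / 2 - J p.2.2 ^ 2 / 4 * (PP A p)⁻¹ - J p.2.2 / 2 * (PT A1 p * (PP A p)⁻¹) - PP A p * A p.2.2

def fY (A A1 J J1 : ℝ → ℝ) (p : Pt) : ℝ :=
  J1 p.2.2 / 2 - J p.2.2 ^ 2 / 4 * (PP A p)⁻¹ - J p.2.2 / 2 * (PT A1 p * (PP A p)⁻¹) -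
    PP A p * (1 + A p.2.2)

/-- closed form of the Christoffel symbols, `l i j` -/
def Cf (A A1 J J1 : ℝ → ℝ) (p : Pt) : Fin 3 → Fin 3 → Fin 3 → ℝ :=
  ![![![0, 0, fU A J p], ![0, 0, fV A J p], ![fU A J p, fV A J p, fX A A1 J J1 p]],
    ![![0, 0, fU A J p], ![0, 0, fV A J p], ![fU A J p, fV A J p, fY A A1 J J1 p]],
    ![![0, 0, fW A p], ![0, 0, fZ A p], ![fW A p, fZ A p, fT A A1 J p]]]

theorem chr_eq {A A1 J J1 : ℝ → ℝ} (hA : ∀ x, HasDerivAt A (A1 x) x)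
    (hJ : ∀ x, HasDerivAt J (J1 x) x) (p : Pt) (h : PP A p ≠ 0) (l i j : Fin 3) :
    Christoffel (gG A J) p l i j = Cf A A1 J J1 p l i j := by
  simp only [Christoffel, (HD.dg hA hJ p _ _).eq, gG_inv A J p h, Fin.sum_univ_three]
  fin_cases l <;> fin_cases i <;> fin_cases j <;> simp [dg, Cf, fU, fV, fW, fZ, fT, fX, fY] <;> field_simp <;> ring

def dU (A A1 A2 J J1 J2 : ℝ → ℝ) (p : Pt) (i : Fin 3) : ℝ :=
  let P := PP A p
  let a := A p.2.2
  let j := J p.2.2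
  let b := A1 p.2.2
  let k := J1 p.2.2
  let Q := PT A1 p
  let dP : ℝ := ![-a, 1 + a, Q] i
  let da : ℝ := ![0, 0, b] i
  let dj : ℝ := ![0, 0, k] i
  dj * a / 2 / P + j * da / 2 / P - j * a / 2 * dP / P ^ 2

def dV (A A1 A2 J J1 J2 : ℝ → ℝ) (p : Pt) (i : Fin 3) : ℝ :=
  let P := PP A p
  let a := A p.2.2
  let j := J p.2.2
  let b := A1 p.2.2
  let k := J1 p.2.2
  let Q := PT A1 p
  let dP : ℝ := ![-a, 1 + a, Q] i
  let da : ℝ := ![0, 0, b] i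
  let dj : ℝ := ![0, 0, k] i
  0 - (dj * (1 + a) / 2 / P) - j * da / 2 / P + j * (1 + a) / 2 * dP / P ^ 2

def dW (A A1 A2 J J1 J2 : ℝ → ℝ) (p : Pt) (i : Fin 3) : ℝ :=
  let P := PP A p
  let a := A p.2.2
  let b := A1 p.2.2
  let Q := PT A1 p
  let dP : ℝ := ![-a, 1 + a, Q] i
  let da : ℝ := ![0, 0, b] i
  0 - da / P + a * dP / P ^ 2

def dZ (A A1 A2 J J1 J2 : ℝ → ℝ) (p : Pt) (i : Fin 3) : ℝ :=
  let P := PP A p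
  let a := A p.2.2
  let b := A1 p.2.2
  let Q := PT A1 p
  let dP : ℝ := ![-a, 1 + a, Q] i
  let da : ℝ := ![0, 0, b] i
  da / P - (1 + a) * dP / P ^ 2

def dT (A A1 A2 J J1 J2 : ℝ → ℝ) (p : Pt) (i : Fin 3) : ℝ :=
  let P := PP A p
  let a := A p.2.2
  let j := J p.2.2
  let b := A1 p.2.2
  let k := J1 p.2.2
  let Q := PT A1 p
  let dP : ℝ := ![-a, 1 + a, Q] i
  let dj : ℝ := ![0, 0, k] i
  let dQ : ℝ := ![-b, b, PT A2 p] i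
  (dQ + dj / 2) / P - (Q + j / 2) * dP / P ^ 2

def dX (A A1 A2 J J1 J2 : ℝ → ℝ) (p : Pt) (i : Fin 3) : ℝ :=
  let P := PP A p
  let a := A p.2.2
  let j := J p.2.2
  let b := A1 p.2.2
  let k := J1 p.2.2
  let Q := PT A1 p
  let dP : ℝ := ![-a, 1 + a, Q] i
  let da : ℝ := ![0, 0, b] i
  let dj : ℝ := ![0, 0, k] i
  let dk : ℝ := ![0, 0, J2 p.2.2] i
  let dQ : ℝ := ![-b, b, PT A2 p] i
  dk / 2 - j * dj / 2 / P + j ^ 2 / 4 * dP / P ^ 2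
    - dj / 2 * Q / P - j / 2 * dQ / P + j / 2 * Q * dP / P ^ 2 - dP * a - P * da

def dY (A A1 A2 J J1 J2 : ℝ → ℝ) (p : Pt) (i : Fin 3) : ℝ :=
  let P := PP A p
  let a := A p.2.2
  let j := J p.2.2
  let b := A1 p.2.2
  let k := J1 p.2.2
  let Q := PT A1 p
  let dP : ℝ := ![-a, 1 + a, Q] i
  let da : ℝ := ![0, 0, b] i
  let dj : ℝ := ![0, 0, k] i
  let dk : ℝ := ![0, 0, J2 p.2.2] i
  let dQ : ℝ := ![-b, b, PT A2 p] i
  dk / 2 - j * dj / 2 / P + j ^ 2 / 4 * dP / P ^ 2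
    - dj / 2 * Q / P - j / 2 * dQ / P + j / 2 * Q * dP / P ^ 2 - dP * (1 + a) - P * da

def dCf (A A1 A2 J J1 J2 : ℝ → ℝ) (p : Pt) : Fin 3 → Fin 3 → Fin 3 → Fin 3 → ℝ :=
  ![![![fun _ => 0, fun _ => 0, dU A A1 A2 J J1 J2 p], ![fun _ => 0, fun _ => 0, dV A A1 A2 J J1 J2 p], ![dU A A1 A2 J J1 J2 p, dV A A1 A2 J J1 J2 p, dX A A1 A2 J J1 J2 p]],
    ![![fun _ => 0, fun _ => 0, dU A A1 A2 J J1 J2 p], ![fun _ => 0, fun _ => 0, dV A A1 A2 J J1 J2 p], ![dU A A1 A2 J J1 J2 p, dV A A1 A2 J J1 J2 p, dY A A1 A2 J J1 J2 p]],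
    ![![fun _ => 0, fun _ => 0, dW A A1 A2 J J1 J2 p], ![fun _ => 0, fun _ => 0, dZ A A1 A2 J J1 J2 p], ![dW A A1 A2 J J1 J2 p, dZ A A1 A2 J J1 J2 p, dT A A1 A2 J J1 J2 p]]]

theorem HD.Cf {A A1 A2 J J1 J2 : ℝ → ℝ} (hA : ∀ x, HasDerivAt A (A1 x) x)
    (hA1 : ∀ x, HasDerivAt A1 (A2 x) x)
    (hJ : ∀ x, HasDerivAt J (J1 x) x) (hJ1 : ∀ x, HasDerivAt J1 (J2 x) x)
    (p : Pt) (h : _root_.PP A p ≠ 0) (l i j : Fin 3) :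
    HD (fun x => _root_.Cf A A1 J J1 x l i j) p (dCf A A1 A2 J J1 J2 p l i j) := by
  have hP := HD.PP hA p
  have hI := hP.inv h
  have hQ := HD.PT hA1 p
  have ha := HD.th hA p
  have hj := HD.th hJ p
  have hk := HD.th hJ1 p
  have c := fun c => HD.const c p
  have X := (((c (1/2)).mul hk).add (((c (-1/4)).mul (hj.mul hj)).mul hI)).add
    (((c (-1/2)).mul hj).mul (hQ.mul hI))
  have Xt := X.add ((c (-1)).mul (hP.mul ha))
  have Xr := X.add ((c (-1)).mul (hP.mul ((c 1).add ha)))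
  have u := (((c (1/2)).mul hj).mul ha).mul hI
  have v := (((c (-1/2)).mul hj).mul ((c 1).add ha)).mul hI
  have w := ((c (-1)).mul ha).mul hI
  have z := ((c 1).add ha).mul hI
  have T := (hQ.add ((c (1/2)).mul hj)).mul hI
  have h0 := c 0
  have hU : HD (fU A J) p (dU A A1 A2 J J1 J2 p) :=
    u.congr (Filter.Eventually.of_forall fun x => by
      simp only [fU]; try ring)
      (fun i => by simp only [dU]; field_simp; try ring)
  have hV : HD (fV A J) p (dV A A1 A2 J J1 J2 p) :=
    v.congr (Filter.Eventually.of_forall fun x => by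
      simp only [fV]; try ring)
      (fun i => by simp only [dV]; field_simp; try ring)
  have hW : HD (fW A) p (dW A A1 A2 J J1 J2 p) :=
    w.congr (Filter.Eventually.of_forall fun x => by
      simp only [fW]; try ring)
      (fun i => by simp only [dW]; field_simp; try ring)
  have hZ : HD (fZ A) p (dZ A A1 A2 J J1 J2 p) :=
    z.congr (Filter.Eventually.of_forall fun x => by
      simp only [fZ]; try ring)
      (fun i => by simp only [dZ]; field_simp; try ring)
  have hT : HD (fT A A1 J) p (dT A A1 A2 J J1 J2 p) :=
    T.congr (Filter.Eventually.of_forall fun x => by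
      simp only [fT]; try ring)
      (fun i => by simp only [dT]; field_simp; try ring)
  have hX : HD (fX A A1 J J1) p (dX A A1 A2 J J1 J2 p) :=
    Xt.congr (Filter.Eventually.of_forall fun x => by
      simp only [fX]; try ring)
      (fun i => by simp only [dX]; field_simp; try ring)
  have hY : HD (fY A A1 J J1) p (dY A A1 A2 J J1 J2 p) :=
    Xr.congr (Filter.Eventually.of_forall fun x => by
      simp only [fY]; try ring)
      (fun i => by simp only [dY]; field_simp; try ring)
  clear u v w z T X Xt Xr
  fin_cases l <;> fin_cases i <;> fin_cases j
  · exact h0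
  · exact h0
  · exact hU
  · exact h0
  · exact h0
  · exact hV
  · exact hU
  · exact hV
  · exact hX
  · exact h0
  · exact h0
  · exact hU
  · exact h0
  · exact h0
  · exact hV
  · exact hU
  · exact hV
  · exact hY
  · exact h0
  · exact h0
  · exact hW
  · exact h0
  · exact h0
  · exact hZ
  · exact hW
  · exact hZ
  · exact hT

theorem ricci_gG {A A1 A2 J J1 J2 : ℝ → ℝ} (hA : ∀ x, HasDerivAt A (A1 x) x)
    (hA1 : ∀ x, HasDerivAt A1 (A2 x) x)
    (hJ : ∀ x, HasDerivAt J (J1 x) x) (hJ1 : ∀ x, HasDerivAt J1 (J2 x) x)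
    (p : Pt) (h : PP A p ≠ 0) (i j : Fin 3) : RicciT (gG A J) p i j = 0 := by
  have hev : ∀ᶠ x in nhds p, PP A x ≠ 0 := (HD.PP hA p).diff.continuousAt.eventually_ne h
  have hC : ∀ l i j, HD (fun x => Christoffel (gG A J) x l i j) p
      (dCf A A1 A2 J J1 J2 p l i j) := fun l i j =>
    (HD.Cf hA hA1 hJ hJ1 p h l i j).congr
      (hev.mono fun x hx => chr_eq hA hJ x hx l i j) (fun _ => rfl)
  simp only [RicciT, (hC _ _ _).eq, chr_eq hA hJ p h, Fin.sum_univ_three]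
  fin_cases i <;> fin_cases j <;> simp [dCf, Cf, fU, fV, fW, fZ, fT, fX, fY,
    dU, dV, dW, dZ, dT, dX, dY] <;> field_simp <;> ring

/-- **Ricci flatness of the background metric `g_a` in the region where `χ ≡ 1`.**
The Lorentzian metric `−dt² + dr² + (r + a(θ)q)² dθ² + J(θ) dq dθ` with
`a(θ) = a₀ + a₁cos θ + a₂sin θ` has vanishing Ricci curvature wherever
`r + a(θ)q > 0`. -/
theorem stmt15 (a0 a1 a2 : ℝ) (J : ℝ → ℝ) (hJ : ContDiff ℝ (⊤ : ℕ∞) J) (p : Pt)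
    (hpos : 0 < p.2.1 + (a0 + a1 * Real.cos p.2.2 + a2 * Real.sin p.2.2) * (p.2.1 - p.1)) :
    ∀ i j : Fin 3, RicciT (gA a0 a1 a2 J) p i j = 0 := by
  intro i j
  have hA : ∀ x : ℝ, HasDerivAt (fun x => a0 + a1 * Real.cos x + a2 * Real.sin x)
      (a1 * -Real.sin x + a2 * Real.cos x) x := fun x =>
    (((Real.hasDerivAt_cos x).const_mul a1).const_add a0).add
      ((Real.hasDerivAt_sin x).const_mul a2)
  have hA1 : ∀ x : ℝ, HasDerivAt (fun x => a1 * -Real.sin x + a2 * Real.cos x)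
      (a1 * -Real.cos x + a2 * -Real.sin x) x := fun x =>
    ((Real.hasDerivAt_sin x).neg.const_mul a1).add ((Real.hasDerivAt_cos x).const_mul a2)
  have hJ0 : ∀ x, HasDerivAt J (deriv J x) x := fun x =>
    (hJ.differentiable (by simp) x).hasDerivAt
  have hJ1 : ∀ x, HasDerivAt (deriv J) (deriv (deriv J) x) x := fun x =>
    ((contDiff_infty_iff_deriv.1 hJ).2.differentiable (by simp) x).hasDerivAt
  exact ricci_gG hA hA1 hJ0 hJ1 p hpos.ne' i j

end
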